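/- Consider a depth-N linear network where N is even and all dimensions d₀,…,d_N are equal to some d ∈ ℕ. Then there exist target matrices Φ ∈ ℝ^{d×d} for which there are initializations W_1(0),…,W_N(0) that are 0-balanced and non-stationary (the gradient of L^N at the initialization is nonzero), and yet for every learning rate η > 0, gradient descent fails: there exists a positive constant below which the objective ℓ(t) never goes (for all t ≥ 0). -/

import Mathlib

open Matrix

/-- Frobenius norm of a real matrix. -/
noncomputable def frobNorm {n : ℕ} (A : Matrix (Fin n) (Fin n) ℝ) : ℝ :=
  Real.sqrt (∑ i, ∑ j, (A i j) ^ 2)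

/-- `sprod W j k` is the product `W (k-1) * ⋯ * W j` (equal to `1` when `k ≤ j`).
In the paper's 1-based notation, `W j` here is `W_{j+1}`; `sprod W 0 N` is the end-to-end
matrix `W_{1:N}`, `sprod W j N = W_{j+1:N}` and `sprod W 0 j = W_{1:j}`. -/
noncomputable def sprod {n : ℕ} (W : ℕ → Matrix (Fin n) (Fin n) ℝ) (j : ℕ) :
    ℕ → Matrix (Fin n) (Fin n) ℝ
  | 0 => 1
  | (k + 1) => if k < j then 1 else W k * sprod W j k

/-- A product of scalar layers with common factor `c` is the scalar matrix `c ^ (k - j)`. -/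
theorem sprod_eq_pow_smul_one {n : ℕ} {W : ℕ → Matrix (Fin n) (Fin n) ℝ} {c : ℝ} {N : ℕ}
    (hW : ∀ j < N, W j = c • 1) (j k : ℕ) (hk : k ≤ N) :
    sprod W j k = c ^ (k - j) • 1 := by
  induction k with
  | zero => simp [sprod]
  | succ k ih =>
    by_cases hkj : k < j
    · simp [sprod, hkj, Nat.sub_eq_zero_of_le (Nat.succ_le_of_lt hkj)]
    · rw [sprod, if_neg hkj, ih (by omega), hW k (by omega), Nat.succ_sub (not_lt.mp hkj),
        pow_succ']
      simp [smul_smul, mul_comm]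

theorem sprod_sub_neg_one {n : ℕ} {W : ℕ → Matrix (Fin n) (Fin n) ℝ} {c : ℝ} {N : ℕ}
    (hW : ∀ j < N, W j = c • 1) : sprod W 0 N - (-1) = (c ^ N + 1) • 1 := by
  rw [sprod_eq_pow_smul_one hW 0 N le_rfl, Nat.sub_zero, sub_neg_eq_add, add_smul, one_smul]

/-- At scalar layers with common factor `c` and target `-1`, every layer has the same gradient. -/
theorem gradient_of_scalar_layers {n : ℕ} {W : ℕ → Matrix (Fin n) (Fin n) ℝ} {c : ℝ} {N : ℕ}
    (hW : ∀ j < N, W j = c • 1) (j : ℕ) (hj : j < N) :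
    (sprod W (j + 1) N)ᵀ * (sprod W 0 N - (-1)) * (sprod W 0 j)ᵀ =
      (c ^ (N - 1) * (c ^ N + 1)) • 1 := by
  have hexp : c ^ (N - 1) = c ^ (N - (j + 1)) * c ^ j := by
    rw [← pow_add]
    congr 1
    omega
  rw [sprod_sub_neg_one hW, sprod_eq_pow_smul_one hW (j + 1) N le_rfl, sprod_eq_pow_smul_one hW 0 j hj.le,
    Nat.sub_zero, hexp]
  simp only [transpose_smul, transpose_one, smul_mul_assoc, mul_smul_comm, one_mul, smul_smul]
  congr 1
  ring

theorem frobNorm_smul_one_sq {n : ℕ} (c : ℝ) :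
    frobNorm (c • (1 : Matrix (Fin n) (Fin n) ℝ)) ^ 2 = n * c ^ 2 := by
  unfold frobNorm
  rw [Real.sq_sqrt (by positivity)]
  simp [Matrix.smul_apply, Matrix.one_apply]

/-- **Claim** (violating the deficiency margin may cause convergence failure): for a
depth-`N` (`N` even) linear network with all dimensions equal to `d ≥ 1`, there exist a
target `Φ` and a `0`-balanced, non-stationary initialization (some layer has nonzero
gradient) such that gradient descent with any learning rate `η > 0` keeps the objective
bounded away from zero forever. -/
theorem no_margin_convergence_failure
    (N : ℕ) (hNeven : Even N) (hN : 0 < N) (d : ℕ) (hd : 0 < d) :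
    ∃ (Φ : Matrix (Fin d) (Fin d) ℝ) (W₀ : ℕ → Matrix (Fin d) (Fin d) ℝ),
      -- 0-balancedness of the initialization
      (∀ j : ℕ, j + 1 < N → (W₀ (j + 1))ᵀ * W₀ (j + 1) = W₀ j * (W₀ j)ᵀ) ∧
      -- non-stationarity: the gradient of the loss at the initialization is nonzero
      (∃ j : ℕ, j < N ∧
        (sprod W₀ (j + 1) N)ᵀ * (sprod W₀ 0 N - Φ) * (sprod W₀ 0 j)ᵀ ≠ 0) ∧
      ∀ η : ℝ, 0 < η →
        ∀ W : ℕ → ℕ → Matrix (Fin d) (Fin d) ℝ,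
          W 0 = W₀ →
          (∀ t : ℕ, ∀ j < N, W (t + 1) j = W t j -
            η • ((sprod (W t) (j + 1) N)ᵀ * (sprod (W t) 0 N - Φ) * (sprod (W t) 0 j)ᵀ)) →
          ∃ ε : ℝ, 0 < ε ∧ ∀ t : ℕ, ε ≤ 1 / 2 * frobNorm (sprod (W t) 0 N - Φ) ^ 2 := by
  have : NeZero d := ⟨hd.ne'⟩
  refine ⟨-1, fun _ => 1, fun j _ => by simp, ⟨0, hN, ?_⟩, ?_⟩
  · rw [gradient_of_scalar_layers (c := 1) (fun j _ => (one_smul ℝ _).symm) 0 hN]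
    exact smul_ne_zero (by norm_num) one_ne_zero
  · intro η _ W hW₀ hstep
    have hscalar : ∀ t, ∃ c : ℝ, ∀ j < N, W t j = c • 1 := by
      intro t
      induction t with
      | zero => exact ⟨1, fun j _ => by simp [hW₀]⟩
      | succ t ih =>
        obtain ⟨c, hc⟩ := ih
        refine ⟨c - η * (c ^ (N - 1) * (c ^ N + 1)), fun j hj => ?_⟩
        rw [hstep t j hj, gradient_of_scalar_layers hc j hj, hc j hj, smul_smul, sub_smul]
    refine ⟨1 / 2, by norm_num, fun t => ?_⟩
    obtain ⟨c, hc⟩ := hscalar t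
    rw [sprod_sub_neg_one hc, frobNorm_smul_one_sq]
    have hpow : 0 ≤ c ^ N := hNeven.pow_nonneg c
    have hd' : (1 : ℝ) ≤ d := by exact_mod_cast hd
    nlinarith [one_le_mul_of_one_le_of_one_le hd' (one_le_pow₀ (n := 2)
      (le_add_of_nonneg_left hpow : (1 : ℝ) ≤ c ^ N + 1))]
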